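/- G-function recursion inequality. Let v > 0, let n ≥ 1 be an integer, and for m ≥ 1 define G_m(t) = vt(1+vt)^{m−1} e^{vt} for t ≥ 0. Then for all t ≥ 0: G_n(t) + v ∫_0^t G_n(t−s) e^{vs} ds ≤ G_{n+1}(t). -/

import Mathlib

open MeasureTheory

noncomputable section

/-- **G-function recursion inequality** (equation (4.40)). For `v > 0`, `n ≥ 1` and
`G_m(t) = vt(1+vt)^{m-1} e^{vt}` on `[0,∞)`:
`G_n(t) + v ∫_0^t G_n(t-s) e^{vs} ds ≤ G_{n+1}(t)` for all `t ≥ 0`. -/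
theorem G_recursion_inequality
    (v : ℝ) (hv : 0 < v) (n : ℕ) (hn : 1 ≤ n)
    (G : ℕ → ℝ → ℝ)
    (hG : ∀ m : ℕ, 1 ≤ m → ∀ t : ℝ, 0 ≤ t →
      G m t = v * t * (1 + v * t)^(m - 1) * Real.exp (v * t)) :
    ∀ t : ℝ, 0 ≤ t →
      G n t + v * ∫ s in (0:ℝ)..t, G n (t - s) * Real.exp (v * s) ≤ G (n + 1) t := by
  intro t ht
  have key : ‖∫ s in (0:ℝ)..t, G n (t - s) * Real.exp (v * s)‖ ≤ G n t * |t - 0| := by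
    apply intervalIntegral.norm_integral_le_of_norm_le_const
    intro s hs
    rw [Set.uIoc_of_le ht] at hs
    obtain ⟨hs0, hst⟩ := hs
    have hts : 0 ≤ t - s := sub_nonneg.mpr hst
    have hle : v * (t - s) ≤ v * t := mul_le_mul_of_nonneg_left (by linarith) hv.le
    have hvts : 0 ≤ v * (t - s) := mul_nonneg hv.le hts
    have hexp : Real.exp (v * (t - s)) * Real.exp (v * s) = Real.exp (v * t) := by
      rw [← Real.exp_add]
      congr 1
      ring
    rw [hG n hn _ hts, hG n hn _ ht, mul_assoc, hexp, Real.norm_of_nonneg (by positivity)]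
    gcongr
  have h1 := le_trans (Real.le_norm_self _) key
  rw [sub_zero, abs_of_nonneg ht] at h1
  have h2 := mul_le_mul_of_nonneg_left h1 hv.le
  have h3 : G (n + 1) t = (1 + v * t) * G n t := by
    rw [hG n hn _ ht, hG (n + 1) (by omega) _ ht]
    obtain ⟨k, rfl⟩ : ∃ k, n = k + 1 := ⟨n - 1, by omega⟩
    simp only [Nat.add_sub_cancel]
    ring
  rw [h3]
  linarith
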